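/- Let p be an odd prime, let K be a field of characteristic p, and let G be a finite nonabelian p-group containing a cyclic subgroup of index p^2. Then the group algebra KG does not possess a filtered multiplicative K-basis. -/

import Mathlib

/-- `B` is a *filtered multiplicative `K`-basis* of the `K`-algebra `A`:
(0) `B` is a `K`-basis of `A` (linearly independent and spanning);
(1) the product of two elements of `B` is either `0` or again an element of `B`;
(2) `B ∩ rad(A)` is a `K`-basis of the Jacobson radical `rad(A)` of `A`. -/
def IsFilteredMultiplicativeBasis (K : Type*) {A : Type*} [Field K] [Ring A] [Algebra K A]
    (B : Set A) : Prop :=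
  LinearIndependent K ((↑) : B → A) ∧
  Submodule.span K B = ⊤ ∧
  (∀ b₁ ∈ B, ∀ b₂ ∈ B, b₁ * b₂ = 0 ∨ b₁ * b₂ ∈ B) ∧
  LinearIndependent K ((↑) : ↥(B ∩ (((⊥ : Ideal A).jacobson : Ideal A) : Set A)) → A) ∧
  Submodule.span K (B ∩ (((⊥ : Ideal A).jacobson : Ideal A) : Set A)) =
    Submodule.restrictScalars K ((⊥ : Ideal A).jacobson)

section PowersOfSubmodule

variable {K A : Type*} [Field K] [Ring A] [Algebra K A] {I : Submodule K A}

theorem mul_mem_pow_add {m n k : ℕ} {x y : A} (hx : x ∈ I ^ m) (hy : y ∈ I ^ n)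
    (h : m + n = k := by rfl) : x * y ∈ I ^ k := by
  rw [← h, pow_add]
  exact Submodule.mul_mem_mul hx hy

theorem pow_le_pow_of_mul_self_le (hI : I * I ≤ I) {m n : ℕ} (hm : m ≠ 0) (h : m ≤ n) :
    I ^ n ≤ I ^ m := by
  induction n, h using Nat.le_induction with
  | base => exact le_rfl
  | succ n hn ih =>
    obtain ⟨m, rfl⟩ := Nat.exists_eq_succ_of_ne_zero hm
    calc I ^ (n + 1) = I ^ n * I := pow_succ _ _
      _ ≤ I ^ (m + 1) * I := mul_le_mul' ih le_rfl
      _ = I ^ m * (I * I) := by rw [pow_succ, mul_assoc]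
      _ ≤ I ^ m * I := mul_le_mul' le_rfl hI
      _ = I ^ (m + 1) := (pow_succ _ _).symm

/-- A derivation sending every `u ∈ I` to the scalar `f u` modulo `I` lowers powers of `I` by
one. -/
theorem derivation_mem_pow {D : A →ₗ[K] A} {f : A →ₗ[K] K} (hI : I * I ≤ I)
    (hD : ∀ x y, D (x * y) = D x * y + x * D y)
    (hDf : ∀ u ∈ I, D u - f u • (1 : A) ∈ I) {n : ℕ} (hn : n ≠ 0) {x : A}
    (hx : x ∈ I ^ (n + 1)) : D x ∈ I ^ n := by
  induction n generalizing x with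
  | zero => exact absurd rfl hn
  | succ n ih =>
    rw [pow_succ] at hx
    induction hx using Submodule.mul_induction_on' with
    | mem_mul_mem y hy v hv =>
      have hv' : D v = f v • (1 : A) + (D v - f v • (1 : A)) := by abel
      have h2 : y * D v ∈ I ^ (n + 1) := by
        rw [hv', mul_add, mul_smul_comm, mul_one]
        refine add_mem (Submodule.smul_mem _ _ hy) ?_
        exact pow_le_pow_of_mul_self_le hI (Nat.succ_ne_zero n) (Nat.le_succ _)
          (mul_mem_pow_add (n := 1) hy (by simpa using hDf v hv))
      rw [hD]
      refine add_mem ?_ h2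
      rcases Nat.eq_zero_or_pos n with rfl | hn
      · have hy1 : y ∈ I := by simpa using hy
        have hy' : D y = f y • (1 : A) + (D y - f y • (1 : A)) := by abel
        rw [hy', add_mul, smul_mul_assoc, one_mul]
        simp only [zero_add, pow_one]
        exact add_mem (Submodule.smul_mem _ _ hv)
          (hI (Submodule.mul_mem_mul (hDf y hy1) hv))
      · exact mul_mem_pow_add (n := 1) (ih hn.ne' hy) (by simpa using hv)
    | add y _ z _ hy hz => simpa using add_mem hy hz

/-- Every functional vanishing on `I ^ 2` is the symbol of a derivation. -/
def HasDerivations (I : Submodule K A) : Prop :=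
  ∀ f : A →ₗ[K] K, (∀ x ∈ I ^ 2, f x = 0) → ∃ D : A →ₗ[K] A,
    (∀ x y, D (x * y) = D x * y + x * D y) ∧ ∀ u ∈ I, D u - f u • (1 : A) ∈ I

theorem mem_sq_of_mul_mem_cube (hI : I * I ≤ I) (hID : HasDerivations I) (h2 : (2 : K) ≠ 0)
    {u v : A} (hu : u ∈ I) (hv : v ∈ I) {f : A →ₗ[K] K} (hf : ∀ x ∈ I ^ 2, f x = 0)
    (hfu : f u ≠ 0) (huv : u * v ∈ I ^ 3) : v ∈ I ^ 2 := by
  obtain ⟨D, hD, hDf⟩ := hID f hf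
  have hu1 : u ∈ I ^ 1 := by simpa using hu
  have hv1 : v ∈ I ^ 1 := by simpa using hv
  have h := derivation_mem_pow hI hD hDf two_ne_zero huv
  have key : f u • v + f v • u ∈ I ^ 2 := by
    have e : f u • v + f v • u = D (u * v) - (D u - f u • (1 : A)) * v
        - u * (D v - f v • (1 : A)) := by
      rw [hD]
      simp only [sub_mul, mul_sub, smul_mul_assoc, one_mul, mul_smul_comm, mul_one]
      abel
    rw [e]
    exact sub_mem (sub_mem h (mul_mem_pow_add (m := 1) (by simpa using hDf u hu) hv1))
      (mul_mem_pow_add (n := 1) hu1 (by simpa using hDf v hv))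
  have h0 := hf _ key
  simp only [map_add, map_smul, smul_eq_mul] at h0
  have hfv : f v = 0 := by
    have : (2 : K) * f u * f v = 0 := by linear_combination h0
    simpa [h2, hfu] using this
  rw [hfv, zero_smul, add_zero] at key
  exact (Submodule.smul_mem_iff _ hfu).1 key

/-- A combination of the two double commutators of `a` and `b` whose coefficient at the first one
is nonzero does not vanish modulo `I ^ 4`. -/
theorem combination_double_commutators_notMem_pow_four (hI : I * I ≤ I) (hID : HasDerivations I)
    (h2 : (2 : K) ≠ 0) {a b : A} (ha : a ∈ I) (hb : b ∈ I) (hb2 : b ∉ I ^ 2)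
    {f : A →ₗ[K] K} (hf : ∀ x ∈ I ^ 2, f x = 0) (hfa : f a = 1) (hfb : f b = 0)
    (hz : a * b - b * a ∉ I ^ 3) {B : Set A}
    (hB : ∀ x, x = 0 ∨ x ∈ B → x ∉ I ^ 4 → ∃ φ : A →ₗ[K] K, φ x = 1 ∧
      (∀ y, y = 0 ∨ y ∈ B → y ≠ x → φ y = 0) ∧ ∀ y ∈ I ^ 4, φ y = 0)
    (hmem : ∀ x ∈ ({a, b} : Set A), ∀ y ∈ ({a, b} : Set A), ∀ w ∈ ({a, b} : Set A),
      x * y * w = 0 ∨ x * y * w ∈ B) {s t : K} (hs : s ≠ 0) :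
    s • (a * a * b - (2 : K) • (a * b * a) + b * a * a) +
      t • (a * b * b - (2 : K) • (b * a * b) + b * b * a) ∉ I ^ 4 := by
  intro hst
  obtain ⟨D, hD, hDf⟩ := hID f hf
  obtain ⟨i, hi⟩ : ∃ i, D a = 1 + i := ⟨D a - 1, by abel⟩
  have hiI : i ∈ I := by simpa [hi, hfa] using hDf a ha
  have hjI : D b ∈ I := by simpa [hfb] using hDf b hb
  set j := D b
  have hI1 : I ^ 1 = I := pow_one I
  have m2 : ∀ {x y : A}, x ∈ I → y ∈ I → x * y ∈ I ^ 2 := fun hx hy =>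
    mul_mem_pow_add (m := 1) (n := 1) (by rwa [hI1]) (by rwa [hI1])
  have m3 : ∀ {x y w : A}, x ∈ I → y ∈ I → w ∈ I → x * y * w ∈ I ^ 3 := fun hx hy hw =>
    mul_mem_pow_add (n := 1) (m2 hx hy) (by rwa [hI1])
  have D4 : ∀ {x}, x ∈ I ^ 4 → D x ∈ I ^ 3 := fun hx =>
    derivation_mem_pow hI hD hDf three_ne_zero hx
  have hab : a * b ∉ I ^ 3 := fun h =>
    hb2 (mem_sq_of_mul_mem_cube hI hID h2 ha hb hf (by simp [hfa]) h)
  have hDaab : D (a * a * b) - (2 : K) • (a * b) ∈ I ^ 3 := by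
    have e : D (a * a * b) - (2 : K) • (a * b) = i * a * b + a * i * b + a * a * j := by
      rw [hD, hD, hi, two_smul]; noncomm_ring
    rw [e]
    exact add_mem (add_mem (m3 hiI ha hb) (m3 ha hiI hb)) (m3 ha ha hjI)
  have haab : a * a * b ∉ I ^ 4 := fun h => hab <| by
    have := sub_mem (D4 h) hDaab
    rw [sub_sub_cancel] at this
    exact (Submodule.smul_mem_iff _ h2).1 this
  have hne : ∀ m, D m - b * b ∈ I ^ 3 → m ≠ a * a * b := by
    rintro _ h rfl
    have h3 : ((2 : K) • a - b) * b ∈ I ^ 3 := by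
      have := sub_mem h hDaab
      rw [sub_sub_sub_cancel_left] at this
      rwa [sub_mul, smul_mul_assoc]
    exact hb2 (mem_sq_of_mul_mem_cube hI hID h2 (sub_mem (I.smul_mem _ ha) hb) hb hf
      (by simp [hfa, hfb, h2]) h3)
  have h1 : a * b * b ≠ a * a * b := hne _ <| by
    have e : D (a * b * b) - b * b = i * b * b + a * j * b + a * b * j := by
      rw [hD, hD, hi]; noncomm_ring
    rw [e]
    exact add_mem (add_mem (m3 hiI hb hb) (m3 ha hjI hb)) (m3 ha hb hjI)
  have h1' : b * a * b ≠ a * a * b := hne _ <| by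
    have e : D (b * a * b) - b * b = j * a * b + b * i * b + b * a * j := by
      rw [hD, hD, hi]; noncomm_ring
    rw [e]
    exact add_mem (add_mem (m3 hjI ha hb) (m3 hb hiI hb)) (m3 hb ha hjI)
  have h1'' : b * b * a ≠ a * a * b := hne _ <| by
    have e : D (b * b * a) - b * b = j * b * a + b * j * a + b * b * i := by
      rw [hD, hD, hi]; noncomm_ring
    rw [e]
    exact add_mem (add_mem (m3 hjI hb ha) (m3 hb hjI ha)) (m3 hb hb hiI)
  obtain ⟨φ, hφ1, hφ0, hφI⟩ := hB _ (hmem a (by simp) a (by simp) b (by simp)) haab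
  have haba : a * b * a = a * a * b := by
    by_contra hc
    have h := hφI _ hst
    have e1 := hφ0 _ (hmem a (by simp) b (by simp) a (by simp)) hc
    have e2 := hφ0 _ (hmem a (by simp) b (by simp) b (by simp)) h1
    have e3 := hφ0 _ (hmem b (by simp) a (by simp) b (by simp)) h1'
    have e4 := hφ0 _ (hmem b (by simp) b (by simp) a (by simp)) h1''
    simp only [map_add, map_sub, map_smul, smul_eq_mul, hφ1, e1, e2, e3, e4] at h
    by_cases hc' : b * a * a = a * a * b
    · rw [hc', hφ1] at h
      have : s * 2 = 0 := by linear_combination h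
      simp [hs, h2] at this
    · rw [hφ0 _ (hmem b (by simp) a (by simp) a (by simp)) hc'] at h
      exact hs (by linear_combination h)
  have hDz : D (a * (a * b - b * a)) ∈ I ^ 3 := by
    rw [mul_sub, ← mul_assoc, ← mul_assoc, haba, sub_self, map_zero]
    exact zero_mem _
  refine hz ?_
  have e : a * b - b * a = D (a * (a * b - b * a)) - (i * a * b - i * b * a)
      - (a * i * b + a * a * j - a * j * a - a * b * i) := by
    rw [hD, map_sub, hD, hD, hi]; noncomm_ring
  rw [e]
  exact sub_mem (sub_mem hDz (sub_mem (m3 hiI ha hb) (m3 hiI hb ha)))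
    (sub_mem (sub_mem (add_mem (m3 ha hiI hb) (m3 ha ha hjI)) (m3 ha hjI ha)) (m3 ha hb hiI))

end PowersOfSubmodule

section MultiplicativeBasis

variable {K A : Type*} [Field K] [Ring A] [Algebra K A] {I : Submodule K A} {B : Set A}

theorem span_inter_pow (hmul : ∀ x ∈ B, ∀ y ∈ B, x * y = 0 ∨ x * y ∈ B)
    (hspan : Submodule.span K (B ∩ (I : Set A)) = I) {n : ℕ} (hn : n ≠ 0) :
    Submodule.span K (B ∩ (I ^ n : Submodule K A)) = I ^ n := by
  refine le_antisymm (Submodule.span_le.2 Set.inter_subset_right) ?_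
  induction n with
  | zero => exact absurd rfl hn
  | succ n ih =>
    rcases Nat.eq_zero_or_pos n with rfl | hn
    · simp [hspan]
    · calc I ^ (n + 1)
          ≤ Submodule.span K (B ∩ (I ^ n : Submodule K A)) * Submodule.span K (B ∩ (I : Set A)) := by
            rw [pow_succ, hspan]
            exact mul_le_mul' (ih hn.ne') le_rfl
        _ ≤ _ := by
            rw [Submodule.span_mul_span, Submodule.span_le]
            rintro _ ⟨x, ⟨hxB, hx⟩, y, ⟨hyB, hy⟩, rfl⟩
            change x * y ∈ Submodule.span K (B ∩ (I ^ (n + 1) : Submodule K A))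
            rcases hmul x hxB y hyB with h | h
            · rw [h]
              exact zero_mem _
            · exact Submodule.subset_span ⟨h, mul_mem_pow_add (n := 1) hx (by simpa using hy)⟩

theorem exists_coordinate (hli : LinearIndependent K ((↑) : B → A)) {x : A} (hx : x ∈ B) :
    ∃ φ : A →ₗ[K] K, φ x = 1 ∧ ∀ y, y = 0 ∨ y ∈ B → y ≠ x → φ y = 0 := by
  classical
  obtain ⟨φ, hφ⟩ := ((Module.Basis.span hli).coord
    ⟨x, hx⟩).exists_extend
  have h : ∀ y (hy : y ∈ B), φ y = (Module.Basis.span hli).coord ⟨x, hx⟩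
      (Module.Basis.span hli ⟨y, hy⟩) := fun y hy => by
    rw [← hφ, LinearMap.comp_apply, Module.Basis.span_apply, Submodule.subtype_apply]
  refine ⟨φ, ?_, ?_⟩
  · rw [h x hx, Module.Basis.coord_apply, Module.Basis.repr_self, Finsupp.single_eq_same]
  · rintro y (rfl | hy) hne
    · exact map_zero _
    · rw [h y hy, Module.Basis.coord_apply, Module.Basis.repr_self, Finsupp.single_apply,
        if_neg]
      simpa using hne

theorem exists_coordinate_vanishing (hli : LinearIndependent K ((↑) : B → A))
    (hmul : ∀ x ∈ B, ∀ y ∈ B, x * y = 0 ∨ x * y ∈ B)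
    (hspan : Submodule.span K (B ∩ (I : Set A)) = I) {n : ℕ} (hn : n ≠ 0) {x : A}
    (hx : x = 0 ∨ x ∈ B) (hxn : x ∉ I ^ n) :
    ∃ φ : A →ₗ[K] K, φ x = 1 ∧ (∀ y, y = 0 ∨ y ∈ B → y ≠ x → φ y = 0) ∧
      ∀ y ∈ I ^ n, φ y = 0 := by
  have hxB : x ∈ B := hx.resolve_left fun h => hxn (h ▸ zero_mem _)
  obtain ⟨φ, hφ1, hφ0⟩ := exists_coordinate hli hxB
  refine ⟨φ, hφ1, hφ0, fun y hy => ?_⟩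
  have : I ^ n ≤ LinearMap.ker φ := by
    rw [← span_inter_pow hmul hspan hn, Submodule.span_le]
    rintro z ⟨hzB, hz⟩
    exact hφ0 z (Or.inr hzB) fun h => hxn (h ▸ hz)
  exact this hy

theorem commute_of_generators_commute (hI : I * I ≤ I) (hnil : ∃ n, I ^ n = ⊥)
    (hone : ∀ x : A, ∃ c : K, x - c • (1 : A) ∈ I)
    (hspan : Submodule.span K (B ∩ (I : Set A)) = I)
    (hcomm : ∀ a ∈ B, a ∈ I → a ∉ I ^ 2 → ∀ b ∈ B, b ∈ I → b ∉ I ^ 2 → a * b = b * a)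
    (x y : A) : x * y = y * x := by
  set X : Set A := {a | a ∈ B ∧ a ∈ I ∧ a ∉ I ^ 2}
  set S := Subalgebra.toSubmodule (Algebra.adjoin K X) with hS
  have hXS : X ⊆ S := Algebra.subset_adjoin
  have hSS : S * S ≤ S := (Subalgebra.mul_toSubmodule_le _ _).trans (by simp [hS])
  have hle : I ≤ Submodule.span K X ⊔ I ^ 2 := by
    conv_lhs => rw [← hspan]
    rw [Submodule.span_le]
    rintro a ⟨haB, ha⟩
    by_cases h : a ∈ I ^ 2
    · exact Submodule.mem_sup_right h
    · exact Submodule.mem_sup_left (Submodule.subset_span ⟨haB, ha, h⟩)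
  have hXI : Submodule.span K X ≤ I := Submodule.span_le.2 fun a ha => ha.2.1
  have hXS' : Submodule.span K X ≤ S := Submodule.span_le.2 hXS
  have hpow : ∀ n, n ≠ 0 → I ^ n ≤ (S ⊓ I ^ n) ⊔ I ^ (n + 1) := by
    intro n hn
    induction n with
    | zero => exact absurd rfl hn
    | succ n ih =>
      rcases Nat.eq_zero_or_pos n with rfl | hn
      · simp only [zero_add, pow_one]
        exact hle.trans (sup_le_sup_right (le_inf hXS' hXI) _)
      · calc I ^ (n + 1) ≤ ((S ⊓ I ^ n) ⊔ I ^ (n + 1)) * (Submodule.span K X ⊔ I ^ 2) := by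
              rw [pow_succ]
              exact mul_le_mul' (ih hn.ne') hle
          _ ≤ _ := by
              rw [Submodule.mul_le]
              intro u hu v hv
              obtain ⟨u₁, ⟨hu₁S, hu₁⟩, u₂, hu₂, rfl⟩ := Submodule.mem_sup.1 hu
              obtain ⟨v₁, hv₁, v₂, hv₂, rfl⟩ := Submodule.mem_sup.1 hv
              have hv₁I : v₁ ∈ I ^ 1 := by simpa using hXI hv₁
              rw [mul_add, add_mul u₁ u₂ v₁, add_assoc (u₁ * v₁)]
              refine Submodule.add_mem_sup
                ⟨hSS (Submodule.mul_mem_mul hu₁S (hXS' hv₁)), mul_mem_pow_add hu₁ hv₁I⟩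
                (add_mem (mul_mem_pow_add hu₂ hv₁I) ?_)
              exact mul_mem_pow_add (n := 2) (m := n) (add_mem hu₁
                (pow_le_pow_of_mul_self_le hI hn.ne' (Nat.le_succ n) hu₂)) hv₂
  have hIS : I ≤ S := by
    have h : ∀ n, n ≠ 0 → I ≤ S ⊔ I ^ n := by
      intro n hn
      induction n with
      | zero => exact absurd rfl hn
      | succ n ih =>
        rcases Nat.eq_zero_or_pos n with rfl | hn
        · simp
        · exact (ih hn.ne').trans (sup_le le_sup_left
            ((hpow n hn.ne').trans (sup_le_sup_right inf_le_left _)))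
    obtain ⟨n, hn⟩ := hnil
    have := h (n + 1) n.succ_ne_zero
    rwa [pow_succ, hn, Submodule.bot_mul, sup_bot_eq] at this
  have hmem : ∀ x : A, x ∈ Algebra.adjoin K X := fun x => by
    obtain ⟨c, hc⟩ := hone x
    have h := add_mem (show x - c • (1 : A) ∈ Algebra.adjoin K X from hIS hc)
      (Subalgebra.smul_mem _ (one_mem (Algebra.adjoin K X)) c)
    rwa [sub_add_cancel] at h
  have hc : ∀ a ∈ X, ∀ b ∈ X, a * b = b * a := fun a ha b hb =>
    hcomm a ha.1 ha.2.1 ha.2.2 b hb.1 hb.2.1 hb.2.2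
  have := Algebra.isMulCommutative_adjoin K hc
  exact congrArg Subtype.val
    (mul_comm' (⟨x, hmem x⟩ : Algebra.adjoin K X) ⟨y, hmem y⟩)

/-- If `A = K + I` is noncommutative with `I` nilpotent, and the double commutators of elements
of `I` span at most a line modulo `I ^ 4` as soon as some commutator is nonzero modulo `I ^ 3`,
then `A` has no multiplicative basis compatible with `I`. -/
theorem commute_of_multiplicative_basis (hI : I * I ≤ I) (hID : HasDerivations I)
    (h2 : (2 : K) ≠ 0) (hnil : ∃ n, I ^ n = ⊥)
    (hone : ∀ x : A, ∃ c : K, x - c • (1 : A) ∈ I)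
    (hli : LinearIndependent K ((↑) : B → A))
    (hmul : ∀ x ∈ B, ∀ y ∈ B, x * y = 0 ∨ x * y ∈ B)
    (hspan : Submodule.span K (B ∩ (I : Set A)) = I)
    (hdouble : (∃ u ∈ I, ∃ v ∈ I, u * v - v * u ∉ I ^ 3) → ∃ w : A, ∀ u ∈ I, ∀ v ∈ I, ∀ x ∈ I,
      x * (u * v - v * u) - (u * v - v * u) * x ∈ Submodule.span K {w} ⊔ I ^ 4)
    (x y : A) : x * y = y * x := by
  refine commute_of_generators_commute hI hnil hone hspan (fun a haB ha ha2 b hbB hb hb2 => ?_) x y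
  by_contra hne
  have hab : a ≠ b := fun h => hne (by rw [h])
  obtain ⟨f, hfa, hf0, hf⟩ := exists_coordinate_vanishing hli hmul hspan two_ne_zero
    (Or.inr haB) ha2
  obtain ⟨g, hgb, hg0, hg⟩ := exists_coordinate_vanishing hli hmul hspan two_ne_zero
    (Or.inr hbB) hb2
  have hz : a * b - b * a ∉ I ^ 3 := fun h => by
    have hab3 : a * b ∉ I ^ 3 := fun h =>
      hb2 (mem_sq_of_mul_mem_cube hI hID h2 ha hb hf (by simp [hfa]) h)
    obtain ⟨φ, h1, h0, hφ⟩ := exists_coordinate_vanishing hli hmul hspan three_ne_zero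
      (hmul a haB b hbB) hab3
    have := hφ _ h
    rw [map_sub, h1, h0 _ (hmul b hbB a haB) (Ne.symm hne)] at this
    simp at this
  have hz' : b * a - a * b ∉ I ^ 3 := fun h => hz (by simpa using neg_mem h)
  obtain ⟨w, hw⟩ := hdouble ⟨a, ha, b, hb, hz⟩
  have hmem : ∀ x ∈ ({a, b} : Set A), ∀ y ∈ ({a, b} : Set A), ∀ w ∈ ({a, b} : Set A),
      x * y * w = 0 ∨ x * y * w ∈ B := by
    have hB : ∀ x ∈ ({a, b} : Set A), x ∈ B := by simp [haB, hbB]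
    intro x hx y hy w hw
    rcases hmul x (hB x hx) y (hB y hy) with h | h
    · simp [h]
    · exact hmul _ h w (hB w hw)
  have hcoord : ∀ x, x = 0 ∨ x ∈ B → x ∉ I ^ 4 → ∃ φ : A →ₗ[K] K, φ x = 1 ∧
      (∀ y, y = 0 ∨ y ∈ B → y ≠ x → φ y = 0) ∧ ∀ y ∈ I ^ 4, φ y = 0 :=
    fun x => exists_coordinate_vanishing hli hmul hspan four_ne_zero
  have hA := fun s t => combination_double_commutators_notMem_pow_four (s := s) (t := t) hI hID
    h2 ha hb hb2 hf
    hfa (hf0 b (Or.inr hbB) hab.symm) hz hcoord hmem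
  have hB := fun s t => combination_double_commutators_notMem_pow_four (s := s) (t := t) hI hID
    h2 hb ha ha2 hg
    hgb (hg0 a (Or.inr haB) hab) hz' hcoord (by rwa [Set.pair_comm b a])
  obtain ⟨p, hp, p', hp', hpe⟩ := Submodule.mem_sup.1 (hw a ha b hb a ha)
  obtain ⟨q, hq, q', hq', hqe⟩ := Submodule.mem_sup.1 (hw b hb a ha b hb)
  obtain ⟨k, rfl⟩ := Submodule.mem_span_singleton.1 hp
  obtain ⟨l, rfl⟩ := Submodule.mem_span_singleton.1 hq
  have e1 : a * a * b - (2 : K) • (a * b * a) + b * a * a = k • w + p' := by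
    rw [hpe, two_smul]; noncomm_ring
  have e2 : a * b * b - (2 : K) • (b * a * b) + b * b * a = l • w + q' := by
    rw [hqe, two_smul]; noncomm_ring
  have e1' : b * a * a - (2 : K) • (a * b * a) + a * a * b = k • w + p' := by
    rw [← e1]; abel
  have e2' : b * b * a - (2 : K) • (b * a * b) + a * b * b = l • w + q' := by
    rw [← e2]; abel
  by_cases hl : l = 0
  · refine hB 1 0 one_ne_zero ?_
    rw [e2', hl]
    simpa using hq'
  · refine hA l (-k) hl ?_
    rw [e1, e2]
    have : l • (k • w + p') + -k • (l • w + q') = l • p' - k • q' := by module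
    rw [this]
    exact sub_mem (Submodule.smul_mem _ _ hp') (Submodule.smul_mem _ _ hq')

end MultiplicativeBasis

section PGroup

variable {p : ℕ} {G : Type*} [Group G]

theorem index_zpowers_pow_dvd [Finite G] {H : Subgroup G} (hH : H.index = p ^ 2) {h : G}
    (hh : H = Subgroup.zpowers h) : (Subgroup.zpowers (h ^ p)).index ∣ p ^ 3 := by
  have h1 := H.card_mul_index
  have h2 := (Subgroup.zpowers (h ^ p)).card_mul_index
  rw [← h1, hH, hh, Nat.card_zpowers, Nat.card_zpowers, orderOf_pow] at h2
  obtain ⟨m, hm⟩ := Nat.gcd_dvd_left (orderOf h) p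
  have hpos := orderOf_pos h
  have hg : 0 < (orderOf h).gcd p := Nat.gcd_pos_of_pos_left _ hpos
  have hdiv : orderOf h / (orderOf h).gcd p = m := Nat.div_eq_of_eq_mul_right hg hm
  have hm0 : 0 < m := Nat.pos_of_ne_zero fun h0 =>
    hpos.ne' (hm.trans (by rw [h0, mul_zero]))
  have : (Subgroup.zpowers (h ^ p)).index = (orderOf h).gcd p * p ^ 2 := by
    refine Nat.eq_of_mul_eq_mul_left hm0 ?_
    rw [hdiv] at h2
    rw [h2]
    conv_lhs => rw [hm]
    ring
  rw [this, pow_succ' p 2]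
  exact Nat.mul_dvd_mul_right (Nat.gcd_dvd_right _ _) _

variable [Fact p.Prime]

theorem mul_comm_of_card_dvd_prime_sq (h : Nat.card G ∣ p ^ 2) (a b : G) : a * b = b * a := by
  obtain ⟨k, hk, hc⟩ := (Nat.dvd_prime_pow Fact.out).1 h
  have hfin : Finite G :=
    Nat.finite_of_card_ne_zero (by rw [hc]; exact pow_ne_zero _ (NeZero.ne p))
  interval_cases k
  · have : Subsingleton G := (Nat.card_eq_one_iff_unique.1 (by simpa using hc)).1
    exact Subsingleton.elim _ _
  · have := isCyclic_of_prime_card (p := p) (by simpa using hc)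
    exact mul_comm' a b
  · have := IsPGroup.isMulCommutative_of_card_eq_prime_sq hc
    exact mul_comm' a b

theorem commutator_mem_of_index_dvd_prime_sq {M : Subgroup G} [M.Normal] (h : M.index ∣ p ^ 2)
    (a b : G) : a * b * a⁻¹ * b⁻¹ ∈ M := by
  rw [← QuotientGroup.eq_one_iff]
  have := mul_comm_of_card_dvd_prime_sq h (a : G ⧸ M) b
  simp only [QuotientGroup.mk_mul, QuotientGroup.mk_inv, this]
  group

theorem commutator_commutator_mem_of_index_eq_prime_cube [Finite G] {M : Subgroup G} [M.Normal]
    (h : M.index = p ^ 3) (x a b : G) :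
    x * (a * b * a⁻¹ * b⁻¹) * x⁻¹ * (a * b * a⁻¹ * b⁻¹)⁻¹ ∈ M := by
  have hcard : Nat.card (G ⧸ M) = p ^ 3 := h
  obtain ⟨k, hk, hZ⟩ := IsPGroup.card_center_eq_prime_pow hcard (by norm_num)
  have hidx : (Subgroup.center (G ⧸ M)).index ∣ p ^ 2 := by
    have h1 := (Subgroup.center (G ⧸ M)).card_mul_index
    rw [hcard, hZ] at h1
    obtain ⟨k, rfl⟩ := Nat.exists_eq_succ_of_ne_zero hk.ne'
    refine Dvd.intro_left (p ^ k) (Nat.eq_of_mul_eq_mul_left (NeZero.pos p) ?_)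
    rw [← mul_assoc, ← pow_succ', h1, ← pow_succ']
  have hc := Subgroup.mem_center_iff.1
    (commutator_mem_of_index_dvd_prime_sq hidx (a : G ⧸ M) (b : G ⧸ M)) x
  rw [← QuotientGroup.eq_one_iff]
  simp only [QuotientGroup.mk_mul, QuotientGroup.mk_inv] at hc ⊢
  rw [hc]
  group

/-- A normal subgroup containing all `p`-th powers, with nonabelian quotient, is cyclic with
quotient of order `p ^ 3`. -/
theorem cyclic_and_index_of_pow_mem [Finite G] {H : Subgroup G} (hH : H.index = p ^ 2)
    (hcyc : IsCyclic H) {M : Subgroup G} [M.Normal] (hM : ∀ g : G, g ^ p ∈ M)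
    (hne : ∃ a b : G, a * b * a⁻¹ * b⁻¹ ∉ M) :
    (∃ n : G, M = Subgroup.zpowers n) ∧ M.index = p ^ 3 := by
  obtain ⟨h, hh⟩ := Subgroup.isCyclic_iff_exists_zpowers_eq_top H |>.1 hcyc
  have hdvd := index_zpowers_pow_dvd hH hh.symm
  have hle : Subgroup.zpowers (h ^ p) ≤ M := by simpa using hM h
  have hMdvd := Subgroup.index_dvd_of_le hle
  have hidx : M.index = p ^ 3 := by
    obtain ⟨k, hk, hc⟩ := (Nat.dvd_prime_pow Fact.out).1 (hMdvd.trans hdvd)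
    rcases hk.lt_or_eq with hk | rfl
    · obtain ⟨a, b, hab⟩ := hne
      exact absurd (commutator_mem_of_index_dvd_prime_sq
        (hc ▸ pow_dvd_pow p (Nat.le_of_lt_succ hk)) a b) hab
    · exact hc
  refine ⟨⟨h ^ p, le_antisymm ?_ hle⟩, hidx⟩
  rw [← Subgroup.relIndex_eq_one]
  have h1 := Subgroup.relIndex_mul_index hle
  rw [Nat.dvd_antisymm hdvd (hidx ▸ hMdvd), hidx] at h1
  exact Nat.eq_of_mul_eq_mul_right (pow_pos (NeZero.pos p) 3) (by rw [h1, one_mul])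

end PGroup

section ModularGroupAlgebra

open MonoidAlgebra

variable (K G : Type*) [Field K] [Group G]

/-- The augmentation ideal of the group algebra `K[G]`, as a `K`-subspace. -/
noncomputable def augmentationSubmodule : Submodule K (MonoidAlgebra K G) :=
  Submodule.span K (Set.range fun g => of K G g - 1)

variable {K G}

theorem of_sub_one_mem (g : G) : of K G g - 1 ∈ augmentationSubmodule K G :=
  Submodule.subset_span ⟨g, rfl⟩

theorem augmentationSubmodule_mul_self_le :
    augmentationSubmodule K G * augmentationSubmodule K G ≤ augmentationSubmodule K G := by
  conv_lhs => rw [augmentationSubmodule, Submodule.span_mul_span]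
  rw [Submodule.span_le]
  rintro _ ⟨_, ⟨g, rfl⟩, _, ⟨h, rfl⟩, rfl⟩
  have e : (of K G g - 1) * (of K G h - 1)
      = (of K G (g * h) - 1) - (of K G g - 1) - (of K G h - 1) := by
    rw [map_mul]; noncomm_ring
  change (of K G g - 1) * (of K G h - 1) ∈ augmentationSubmodule K G
  rw [e]
  exact sub_mem (sub_mem (of_sub_one_mem _) (of_sub_one_mem _)) (of_sub_one_mem _)

theorem exists_sub_smul_one_mem (x : MonoidAlgebra K G) :
    ∃ c : K, x - c • (1 : MonoidAlgebra K G) ∈ augmentationSubmodule K G := by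
  induction x using MonoidAlgebra.induction_on with
  | of g => exact ⟨1, by rw [one_smul]; exact of_sub_one_mem g⟩
  | add x y hx hy =>
    obtain ⟨c, hc⟩ := hx
    obtain ⟨d, hd⟩ := hy
    refine ⟨c + d, ?_⟩
    rw [add_smul, add_sub_add_comm]
    exact add_mem hc hd
  | smul r x hx =>
    obtain ⟨c, hc⟩ := hx
    refine ⟨r * c, ?_⟩
    rw [mul_smul, ← smul_sub]
    exact Submodule.smul_mem _ _ hc

theorem hasDerivations_augmentationSubmodule : HasDerivations (augmentationSubmodule K G) := by
  intro f hf
  have hadd : ∀ g h : G, f (of K G (g * h) - 1) = f (of K G g - 1) + f (of K G h - 1) := by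
    intro g h
    have e : of K G (g * h) - 1
        = (of K G g - 1) + (of K G h - 1) + (of K G g - 1) * (of K G h - 1) := by
      rw [map_mul]; noncomm_ring
    have h0 := hf ((of K G g - 1) * (of K G h - 1)) (by
      rw [pow_two]; exact Submodule.mul_mem_mul (of_sub_one_mem g) (of_sub_one_mem h))
    rw [e, map_add, map_add, h0, add_zero]
  let D : MonoidAlgebra K G →ₗ[K] MonoidAlgebra K G :=
    (MonoidAlgebra.basis G K).constr K fun g => f (of K G g - 1) • of K G g
  have hD : ∀ g, D (of K G g) = f (of K G g - 1) • of K G g := fun g =>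
    (MonoidAlgebra.basis G K).constr_basis K _ g
  refine ⟨D, fun x y => ?_, fun u hu => ?_⟩
  · induction x using MonoidAlgebra.induction_on with
    | of g =>
      induction y using MonoidAlgebra.induction_on with
      | of h =>
        rw [← map_mul, hD, hD, hD, hadd, map_mul, add_smul, smul_mul_assoc, mul_smul_comm]
      | add x y hx hy => rw [mul_add, map_add, hx, hy, map_add]; noncomm_ring
      | smul r x hx => rw [mul_smul_comm, map_smul, hx, map_smul, mul_smul_comm, mul_smul_comm,
          smul_add]
    | add x y hx hy => rw [add_mul, map_add, hx, hy, map_add]; noncomm_ring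
    | smul r x hx => rw [smul_mul_assoc, map_smul, hx, map_smul, smul_mul_assoc, smul_mul_assoc,
          smul_add]
  · induction hu using Submodule.span_induction with
    | mem x hx =>
      obtain ⟨g, rfl⟩ := hx
      have h1 : D 1 = 0 := by
        rw [← map_one (of K G), hD, map_one, sub_self, map_zero, zero_smul]
      simp only [map_sub D, hD, h1, sub_zero]
      rw [← smul_sub]
      exact Submodule.smul_mem _ _ (of_sub_one_mem g)
    | zero => simp
    | add x y _ _ hx hy =>
      rw [map_add, map_add, add_smul, add_sub_add_comm]
      exact add_mem hx hy
    | smul r x _ hx =>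
      rw [map_smul, map_smul, smul_eq_mul, mul_smul, ← smul_sub]
      exact Submodule.smul_mem _ _ hx

section Radical

variable {p : ℕ} [Fact p.Prime]

theorem exists_ne_zero_forall_of_smul_eq_of_zmodModule [Finite G] (hG : IsPGroup p G) (M : Type*)
    [AddCommGroup M] [Module (MonoidAlgebra K G) M] [Module (ZMod p) M] [Nontrivial M]
    (hp : ∀ x : M, p • x = 0) : ∃ v : M, v ≠ 0 ∧ ∀ g : G, of K G g • v = v := by
  obtain ⟨v₀, hv₀⟩ := exists_ne (0 : M)
  let L : Submodule (ZMod p) M := Submodule.span (ZMod p) (Set.range fun g : G => of K G g • v₀)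
  have : Module.Finite (ZMod p) ↥L :=
    Module.Finite.iff_fg.2 (Submodule.fg_span (Set.finite_range _))
  have : Finite L := Module.finite_of_finite (ZMod p)
  have hL : ∀ (g : G), ∀ x ∈ L, of K G g • x ∈ L := by
    intro g x hx
    induction hx using Submodule.span_induction with
    | mem x hx =>
      obtain ⟨h, rfl⟩ := hx
      refine Submodule.subset_span ⟨g * h, ?_⟩
      simp only [map_mul, mul_smul]
    | zero => simp
    | add x y _ _ hx hy =>
      rw [smul_add]
      exact add_mem hx hy
    | smul r x _ hx =>
      have : of K G g • r • x = r • of K G g • x :=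
        ZMod.map_smul (DistribSMul.toAddMonoidHom M (of K G g)) r x
      rw [this]
      exact Submodule.smul_mem _ _ hx
  let : MulAction G L :=
    { smul := fun g x => ⟨of K G g • (x : M), hL g x x.2⟩
      one_smul := fun x => Subtype.ext (show of K G 1 • (x : M) = x by rw [map_one, one_smul])
      mul_smul := fun g h x => Subtype.ext
        (show of K G (g * h) • (x : M) = of K G g • of K G h • (x : M) by
          rw [map_mul, mul_smul]) }
  have hdvd : p ∣ Nat.card L := by
    have hv : v₀ ∈ L := Submodule.subset_span ⟨1, by simp only [map_one, one_smul]⟩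
    have : addOrderOf (⟨v₀, hv⟩ : L) = p :=
      addOrderOf_eq_prime (Subtype.ext (hp v₀)) fun h => hv₀ (congrArg Subtype.val h)
    have hd := addOrderOf_dvd_natCard (⟨v₀, hv⟩ : L)
    rwa [this] at hd
  obtain ⟨b, hb, hne⟩ := hG.exists_fixed_point_of_prime_dvd_card_of_fixed_point L hdvd (a := 0)
    fun g => Subtype.ext (smul_zero (of K G g))
  exact ⟨b, fun h => hne (Subtype.ext h.symm), fun g => congrArg Subtype.val (hb g)⟩

variable [CharP K p]

theorem exists_ne_zero_forall_of_smul_eq [Finite G] (hG : IsPGroup p G) (M : Type*)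
    [AddCommGroup M] [Module (MonoidAlgebra K G) M] [Nontrivial M] :
    ∃ v : M, v ≠ 0 ∧ ∀ g : G, of K G g • v = v := by
  have hp : ∀ x : M, p • x = 0 := fun x => by
    rw [← Nat.cast_smul_eq_nsmul (MonoidAlgebra K G) p x,
      ← map_natCast (algebraMap K (MonoidAlgebra K G)) p, CharP.cast_eq_zero, map_zero, zero_smul]
  let : Module (ZMod p) M := AddCommGroup.zmodModule hp
  exact exists_ne_zero_forall_of_smul_eq_of_zmodModule hG M hp

theorem of_sub_one_mem_jacobson [Finite G] (hG : IsPGroup p G) (g : G) :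
    of K G g - 1 ∈ (⊥ : Ideal (MonoidAlgebra K G)).jacobson := by
  rw [Ideal.jacobson, Ideal.mem_sInf]
  rintro m ⟨-, hm⟩
  have : IsSimpleModule (MonoidAlgebra K G) (MonoidAlgebra K G ⧸ m) :=
    isSimpleModule_iff_isCoatom.2 hm.out
  have := IsSimpleModule.nontrivial (MonoidAlgebra K G) (MonoidAlgebra K G ⧸ m)
  obtain ⟨v, hv0, hv⟩ := exists_ne_zero_forall_of_smul_eq (K := K) hG (MonoidAlgebra K G ⧸ m)
  let F : Submodule (MonoidAlgebra K G) (MonoidAlgebra K G ⧸ m) :=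
    { carrier := {x | ∀ g : G, of K G g • x = x}
      zero_mem' := fun g => smul_zero _
      add_mem' := fun hx hy g => by rw [smul_add, hx g, hy g]
      smul_mem' := fun r x hx g => by
        induction r using MonoidAlgebra.induction_on with
        | of h => rw [hx h, hx g]
        | add y z hy hz => rw [add_smul, smul_add, hy, hz]
        | smul c y hy =>
          rw [Algebra.smul_def, mul_smul, ← mul_smul, ← Algebra.commutes, mul_smul, hy] }
  have hF : F = ⊤ := (eq_bot_or_eq_top F).resolve_left fun h =>
    hv0 ((Submodule.eq_bot_iff F).1 h v hv)
  have h1 : Submodule.Quotient.mk 1 ∈ F := hF ▸ Submodule.mem_top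
  have h2 := h1 g
  rw [← Submodule.Quotient.mk_smul, Submodule.Quotient.eq, smul_eq_mul, mul_one] at h2
  exact h2

theorem restrictScalars_jacobson_eq [Finite G] (hG : IsPGroup p G) :
    Submodule.restrictScalars K (⊥ : Ideal (MonoidAlgebra K G)).jacobson
      = augmentationSubmodule K G := by
  have hle : augmentationSubmodule K G
      ≤ Submodule.restrictScalars K (⊥ : Ideal (MonoidAlgebra K G)).jacobson := by
    rw [augmentationSubmodule, Submodule.span_le]
    rintro _ ⟨g, rfl⟩
    exact of_sub_one_mem_jacobson hG g
  refine le_antisymm (fun x hx => ?_) hle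
  obtain ⟨c, hc⟩ := exists_sub_smul_one_mem x
  have hc1 : c • (1 : MonoidAlgebra K G)
      ∈ Submodule.restrictScalars K (⊥ : Ideal (MonoidAlgebra K G)).jacobson := by
    simpa using sub_mem hx (hle hc)
  by_cases h0 : c = 0
  · simpa [h0] using hc
  · rw [Submodule.smul_mem_iff _ h0, Submodule.restrictScalars_mem,
      ← Ideal.eq_top_iff_one, Ideal.jacobson_eq_top_iff] at hc1
    exact absurd hc1 bot_ne_top

theorem exists_augmentationSubmodule_pow_eq_bot [Finite G] (hG : IsPGroup p G) :
    ∃ n, augmentationSubmodule K G ^ n = ⊥ := by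
  have : Module.Finite K (MonoidAlgebra K G) := Module.Finite.of_basis (MonoidAlgebra.basis G K)
  have : IsArtinianRing (MonoidAlgebra K G) := IsArtinianRing.of_finite K _
  obtain ⟨n, hn⟩ := IsArtinianRing.isNilpotent_jacobson_bot (R := MonoidAlgebra K G)
  have hle : ∀ n, augmentationSubmodule K G ^ n
      ≤ Submodule.restrictScalars K ((⊥ : Ideal (MonoidAlgebra K G)).jacobson ^ n) := by
    intro n
    induction n with
    | zero =>
      rw [Submodule.pow_zero (⊥ : Ideal (MonoidAlgebra K G)).jacobson, Ideal.one_eq_top]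
      exact le_top
    | succ n ih =>
      rw [pow_succ, Submodule.pow_succ, Submodule.mul_le]
      intro x hx y hy
      rw [← restrictScalars_jacobson_eq hG] at hy
      exact Ideal.mul_mem_mul (ih hx) hy
  refine ⟨n, le_bot_iff.1 ((hle n).trans ?_)⟩
  rw [hn]
  simp

end Radical

section DimensionSubgroup

theorem mul_mem_augmentationSubmodule_pow {n : ℕ} (hn : n ≠ 0) {x : MonoidAlgebra K G}
    (hx : x ∈ augmentationSubmodule K G ^ n) (y : MonoidAlgebra K G) :
    x * y ∈ augmentationSubmodule K G ^ n ∧ y * x ∈ augmentationSubmodule K G ^ n := by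
  obtain ⟨c, hc⟩ := exists_sub_smul_one_mem y
  rw [← pow_one (augmentationSubmodule K G)] at hc
  have hy : y = (y - c • 1) + c • 1 := (sub_add_cancel _ _).symm
  have hle := pow_le_pow_of_mul_self_le (augmentationSubmodule_mul_self_le (K := K) (G := G)) hn
    n.le_succ
  rw [hy, mul_add, add_mul, mul_smul_comm, smul_mul_assoc, mul_one, one_mul]
  exact ⟨add_mem (hle (mul_mem_pow_add hx hc)) (Submodule.smul_mem _ _ hx),
    add_mem (hle (mul_mem_pow_add hc hx (add_comm 1 n))) (Submodule.smul_mem _ _ hx)⟩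

variable (K G) in
/-- The third dimension subgroup of `G` over `K`: the elements congruent to `1` modulo the
cube of the augmentation ideal. -/
noncomputable def dimensionSubgroupThree : Subgroup G where
  carrier := {g | of K G g - 1 ∈ augmentationSubmodule K G ^ 3}
  one_mem' := by
    rw [Set.mem_ofPred_eq, map_one, sub_self]
    exact zero_mem _
  mul_mem' := fun {g h} hg hh => by
    have e : of K G (g * h) - 1 = (of K G g - 1) * of K G h + (of K G h - 1) := by
      rw [map_mul]; noncomm_ring
    rw [Set.mem_ofPred_eq, e]
    exact add_mem (mul_mem_augmentationSubmodule_pow three_ne_zero hg _).1 hh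
  inv_mem' := fun {g} hg => by
    have e : of K G g⁻¹ - 1 = -((of K G g - 1) * of K G g⁻¹) := by
      rw [sub_mul, ← map_mul, mul_inv_cancel, map_one]; noncomm_ring
    rw [Set.mem_ofPred_eq, e]
    exact neg_mem (mul_mem_augmentationSubmodule_pow three_ne_zero hg _).1

theorem mem_dimensionSubgroupThree {g : G} : g ∈ dimensionSubgroupThree K G ↔
    of K G g - 1 ∈ augmentationSubmodule K G ^ 3 := Iff.rfl

instance normal_dimensionSubgroupThree : (dimensionSubgroupThree K G).Normal where
  conj_mem g hg x := by
    have e : of K G (x * g * x⁻¹) - 1 = of K G x * (of K G g - 1) * of K G x⁻¹ := by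
      rw [mul_sub, sub_mul, mul_one, ← map_mul, ← map_mul, ← map_mul, mul_inv_cancel, map_one]
    rw [mem_dimensionSubgroupThree, e]
    exact (mul_mem_augmentationSubmodule_pow three_ne_zero
      (mul_mem_augmentationSubmodule_pow three_ne_zero hg _).2 _).1

theorem pow_mem_dimensionSubgroupThree {p : ℕ} [Fact p.Prime] [CharP K p] (hp : 3 ≤ p) (g : G) :
    g ^ p ∈ dimensionSubgroupThree K G := by
  have : CharP (MonoidAlgebra K G) p := charP_of_injective_algebraMap
    (algebraMap K (MonoidAlgebra K G)).injective p
  rw [mem_dimensionSubgroupThree, map_pow, ← one_pow (M := MonoidAlgebra K G) p,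
    ← sub_pow_char_of_commute p (Commute.one_right _)]
  have hle := pow_le_pow_of_mul_self_le
    (augmentationSubmodule_mul_self_le (K := K) (G := G)) three_ne_zero hp
  exact hle (Submodule.pow_mem_pow _ (of_sub_one_mem g) p)

theorem commutator_of_sub_one (a b : G) :
    (of K G a - 1) * (of K G b - 1) - (of K G b - 1) * (of K G a - 1)
      = (of K G (a * b * a⁻¹ * b⁻¹) - 1) * of K G (b * a) := by
  rw [sub_mul (of K G (a * b * a⁻¹ * b⁻¹)), ← map_mul (of K G),
    show a * b * a⁻¹ * b⁻¹ * (b * a) = a * b by group, map_mul, map_mul]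
  noncomm_ring

theorem of_commutator_sub_one_mem (a b : G) :
    of K G (a * b * a⁻¹ * b⁻¹) - 1 ∈ augmentationSubmodule K G ^ 2 := by
  have e : of K G (a * b * a⁻¹ * b⁻¹) - 1
      = (of K G (a * b * a⁻¹ * b⁻¹) - 1) * of K G (b * a) * of K G (b * a)⁻¹ := by
    rw [mul_assoc (_ - _), ← map_mul (of K G) (b * a), mul_inv_cancel, map_one, mul_one]
  rw [e, ← commutator_of_sub_one]
  refine (mul_mem_augmentationSubmodule_pow two_ne_zero ?_ _).1
  rw [pow_two]
  exact sub_mem (Submodule.mul_mem_mul (of_sub_one_mem a) (of_sub_one_mem b))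
    (Submodule.mul_mem_mul (of_sub_one_mem b) (of_sub_one_mem a))

theorem commutator_mem_of_forall_of {N : Submodule K (MonoidAlgebra K G)}
    (h : ∀ a b : G, (of K G a - 1) * (of K G b - 1) - (of K G b - 1) * (of K G a - 1) ∈ N)
    {u v : MonoidAlgebra K G} (hu : u ∈ augmentationSubmodule K G)
    (hv : v ∈ augmentationSubmodule K G) : u * v - v * u ∈ N := by
  induction hu, hv using Submodule.span_induction₂ with
  | mem_mem x y hx hy =>
    obtain ⟨a, rfl⟩ := hx
    obtain ⟨b, rfl⟩ := hy
    exact h a b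
  | zero_left y hy => simp
  | zero_right y hy => simp
  | add_left x y z _ _ _ h₁ h₂ =>
    rw [add_mul, mul_add, add_sub_add_comm]
    exact add_mem h₁ h₂
  | add_right x y z _ _ _ h₁ h₂ =>
    rw [add_mul, mul_add, add_sub_add_comm]
    exact add_mem h₁ h₂
  | smul_left r x y _ _ h =>
    rw [smul_mul_assoc, mul_smul_comm, ← smul_sub]
    exact Submodule.smul_mem _ _ h
  | smul_right r x y _ _ h =>
    rw [smul_mul_assoc, mul_smul_comm, ← smul_sub]
    exact Submodule.smul_mem _ _ h

theorem exists_commutator_notMem {u v : MonoidAlgebra K G} (hu : u ∈ augmentationSubmodule K G)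
    (hv : v ∈ augmentationSubmodule K G) (huv : u * v - v * u ∉ augmentationSubmodule K G ^ 3) :
    ∃ a b : G, a * b * a⁻¹ * b⁻¹ ∉ dimensionSubgroupThree K G := by
  by_contra! h
  refine huv (commutator_mem_of_forall_of (fun a b => ?_) hu hv)
  rw [commutator_of_sub_one]
  exact (mul_mem_augmentationSubmodule_pow three_ne_zero (h a b) _).1

theorem of_sub_one_mem_span_sup [Finite G] {n : G}
    (hn : dimensionSubgroupThree K G = Subgroup.zpowers n) {m : G}
    (hm : m ∈ dimensionSubgroupThree K G) :
    of K G m - 1 ∈ Submodule.span K {of K G n - 1} ⊔ augmentationSubmodule K G ^ 4 := by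
  have hn3 : of K G n - 1 ∈ augmentationSubmodule K G ^ 3 :=
    mem_dimensionSubgroupThree.1 (hn ▸ Subgroup.mem_zpowers n)
  rw [hn, ← mem_powers_iff_mem_zpowers] at hm
  obtain ⟨k, rfl⟩ := hm
  dsimp only
  induction k with
  | zero =>
    rw [pow_zero, map_one, sub_self]
    exact zero_mem _
  | succ k ih =>
    have hk : of K G (n ^ k) - 1 ∈ augmentationSubmodule K G ^ 3 :=
      mem_dimensionSubgroupThree.1 (hn ▸ Subgroup.npow_mem_zpowers n k)
    have e : of K G (n ^ (k + 1)) - 1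
        = (of K G (n ^ k) - 1) + (of K G n - 1) + (of K G (n ^ k) - 1) * (of K G n - 1) := by
      rw [pow_succ, map_mul]; noncomm_ring
    rw [e]
    refine add_mem (add_mem ih (Submodule.mem_sup_left (Submodule.mem_span_singleton_self _)))
      (Submodule.mem_sup_right ?_)
    have hle := pow_le_pow_of_mul_self_le
      (augmentationSubmodule_mul_self_le (K := K) (G := G)) four_ne_zero
      (by norm_num : 4 ≤ 6)
    exact hle (mul_mem_pow_add hk hn3)

theorem double_commutator_mem [Finite G] {n : G}
    (hn : dimensionSubgroupThree K G = Subgroup.zpowers n)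
    (hc : ∀ x a b : G, x * (a * b * a⁻¹ * b⁻¹) * x⁻¹ * (a * b * a⁻¹ * b⁻¹)⁻¹
      ∈ dimensionSubgroupThree K G) {u v x : MonoidAlgebra K G}
    (hu : u ∈ augmentationSubmodule K G) (hv : v ∈ augmentationSubmodule K G)
    (hx : x ∈ augmentationSubmodule K G) :
    x * (u * v - v * u) - (u * v - v * u) * x
      ∈ Submodule.span K {of K G n - 1} ⊔ augmentationSubmodule K G ^ 4 := by
  suffices h : ∀ (g a b : G), (of K G g - 1) * ((of K G (a * b * a⁻¹ * b⁻¹) - 1) * of K G (b * a))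
      - ((of K G (a * b * a⁻¹ * b⁻¹) - 1) * of K G (b * a)) * (of K G g - 1)
        ∈ Submodule.span K {of K G n - 1} ⊔ augmentationSubmodule K G ^ 4 by
    induction hx using Submodule.span_induction with
    | mem x hx =>
      obtain ⟨g, rfl⟩ := hx
      have key := commutator_mem_of_forall_of (N := Submodule.comap
        (LinearMap.mulLeft K (of K G g - 1) - LinearMap.mulRight K (of K G g - 1))
        (Submodule.span K {of K G n - 1} ⊔ augmentationSubmodule K G ^ 4))
        (fun a b => ?_) hu hv
      · rwa [Submodule.mem_comap, LinearMap.sub_apply, LinearMap.mulLeft_apply,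
          LinearMap.mulRight_apply] at key
      rw [commutator_of_sub_one, Submodule.mem_comap, LinearMap.sub_apply,
        LinearMap.mulLeft_apply, LinearMap.mulRight_apply]
      exact h g a b
    | zero => simp
    | add x y _ _ hx hy =>
      rw [add_mul, mul_add, add_sub_add_comm]
      exact add_mem hx hy
    | smul r x _ hx =>
      rw [smul_mul_assoc, mul_smul_comm, ← smul_sub]
      exact Submodule.smul_mem _ _ hx
  intro g a b
  have hm := hc g a b
  have hc2 := of_commutator_sub_one_mem (K := K) a b
  set c := a * b * a⁻¹ * b⁻¹
  set m := g * c * g⁻¹ * c⁻¹ with hmdef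
  have hgc : of K G g * of K G c = of K G m * of K G (c * g) := by
    rw [← map_mul, ← map_mul, hmdef]
    congr 1
    group
  have e : (of K G g - 1) * ((of K G c - 1) * of K G (b * a))
      - ((of K G c - 1) * of K G (b * a)) * (of K G g - 1)
      = (of K G m - 1) + ((of K G m - 1) * (of K G (c * g) - 1)
        + (of K G g - 1) * ((of K G c - 1) * (of K G (b * a) - 1))
        - ((of K G c - 1) * (of K G (b * a) - 1)) * (of K G g - 1)) := by
    have : (of K G g - 1) * (of K G c - 1) - (of K G c - 1) * (of K G g - 1)
        = (of K G m - 1) + (of K G m - 1) * (of K G (c * g) - 1) := by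
      calc _ = of K G g * of K G c - of K G c * of K G g := by noncomm_ring
        _ = of K G m * of K G (c * g) - of K G (c * g) := by rw [hgc, map_mul (of K G) c g]
        _ = _ := by noncomm_ring
    rw [add_sub_assoc, ← add_assoc, ← this]
    noncomm_ring
  have h1 : ∀ g : G, of K G g - 1 ∈ augmentationSubmodule K G ^ 1 := fun g => by
    rw [pow_one]; exact of_sub_one_mem g
  have h3 : (of K G c - 1) * (of K G (b * a) - 1) ∈ augmentationSubmodule K G ^ 3 :=
    mul_mem_pow_add hc2 (h1 (b * a))
  have hm3 := mem_dimensionSubgroupThree.1 hm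
  rw [e]
  exact add_mem (of_sub_one_mem_span_sup hn hm) (Submodule.mem_sup_right
    (sub_mem (add_mem (mul_mem_pow_add hm3 (h1 _)) (mul_mem_pow_add (h1 g) h3))
      (mul_mem_pow_add h3 (h1 g))))

theorem exists_forall_double_commutator_mem [Finite G] {p : ℕ} [Fact p.Prime] [CharP K p]
    (hp : 3 ≤ p) {H : Subgroup G} (hH : IsCyclic H) (hindex : H.index = p ^ 2)
    {a b : MonoidAlgebra K G} (ha : a ∈ augmentationSubmodule K G)
    (hb : b ∈ augmentationSubmodule K G) (hab : a * b - b * a ∉ augmentationSubmodule K G ^ 3) :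
    ∃ w : MonoidAlgebra K G, ∀ u ∈ augmentationSubmodule K G, ∀ v ∈ augmentationSubmodule K G,
      ∀ x ∈ augmentationSubmodule K G, x * (u * v - v * u) - (u * v - v * u) * x
        ∈ Submodule.span K {w} ⊔ augmentationSubmodule K G ^ 4 := by
  obtain ⟨⟨n, hn⟩, hM⟩ := cyclic_and_index_of_pow_mem hindex hH
    (pow_mem_dimensionSubgroupThree (K := K) hp) (exists_commutator_notMem ha hb hab)
  exact ⟨of K G n - 1, fun u hu v hv x hx => double_commutator_mem hn
    (commutator_commutator_mem_of_index_eq_prime_cube hM) hu hv hx⟩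

end DimensionSubgroup

end ModularGroupAlgebra

/-- If `p` is odd, `K` a field of characteristic `p`, and `G` a finite nonabelian
`p`-group with a cyclic subgroup of index `p²`, then `KG` has no filtered
multiplicative `K`-basis. -/
theorem no_filtered_mult_basis_cyclic_index_p_squared (p : ℕ) [Fact p.Prime] (hp : Odd p)
    (K : Type*) [Field K] [CharP K p]
    (G : Type*) [Group G] [Fintype G] (hG : IsPGroup p G)
    (hnab : ∃ x y : G, x * y ≠ y * x)
    (hcyc : ∃ H : Subgroup G, IsCyclic H ∧ H.index = p ^ 2) :
    ¬ ∃ B : Set (MonoidAlgebra K G), IsFilteredMultiplicativeBasis K B := by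
  have hp2 : p ≠ 2 := by rintro rfl; exact absurd hp (by decide)
  have hp3 : 3 ≤ p := by have := (Fact.out : p.Prime).two_le; omega
  have h2 : (2 : K) ≠ 0 := Ring.two_ne_zero (by rwa [ringChar.eq K p])
  rintro ⟨B, hli, -, hmul, -, hspan⟩
  obtain ⟨H, hH, hindex⟩ := hcyc
  obtain ⟨x, y, hxy⟩ := hnab
  have hrad := restrictScalars_jacobson_eq (K := K) hG
  have hset : (((⊥ : Ideal (MonoidAlgebra K G)).jacobson : Ideal _) : Set (MonoidAlgebra K G))
      = augmentationSubmodule K G := congrArg SetLike.coe hrad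
  rw [hrad, hset] at hspan
  have hcomm : ∀ a b : MonoidAlgebra K G, a * b = b * a :=
    commute_of_multiplicative_basis augmentationSubmodule_mul_self_le
      hasDerivations_augmentationSubmodule h2 (exists_augmentationSubmodule_pow_eq_bot hG)
      exists_sub_smul_one_mem hli hmul hspan
      fun ⟨u, hu, v, hv, huv⟩ => exists_forall_double_commutator_mem hp3 hH hindex hu hv huv
  refine hxy (MonoidAlgebra.of_injective (R := K) ?_)
  rw [map_mul, map_mul]
  exact hcomm _ _
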